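/- For every quaternion polynomial A ∈ ℍ[t], the polynomial A·i·Ā is vectorial, i.e. A·i·Ā + (A·i·Ā)‾ = 0; and writing A·i·Ā = F₁·i + F₂·j + F₃·k with F₁, F₂, F₃ ∈ ℝ[t], the Pythagorean condition F₁² + F₂² + F₃² = (A·Ā)² holds in ℝ[t]. -/

import Mathlib

open Polynomial

noncomputable section

/-- The quaternion unit `i`. -/
def qi : Quaternion ℝ := ⟨0, 1, 0, 0⟩
/-- The quaternion unit `j`. -/
def qj : Quaternion ℝ := ⟨0, 0, 1, 0⟩
/-- The quaternion unit `k`. -/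
def qk : Quaternion ℝ := ⟨0, 0, 0, 1⟩

/-- Embedding of real polynomials into quaternion polynomials (scalar coefficients). -/
def toQ : Polynomial ℝ →+* Polynomial (Quaternion ℝ) :=
  mapRingHom (algebraMap ℝ (Quaternion ℝ))

/-- Coefficientwise quaternion conjugation of a quaternion polynomial. -/
def pconj (p : Polynomial (Quaternion ℝ)) : Polynomial (Quaternion ℝ) :=
  p.sum fun n a => monomial n (star a)

theorem coeff_pconj (p : Polynomial (Quaternion ℝ)) (n : ℕ) :
    (pconj p).coeff n = star (p.coeff n) := by
  rw [pconj, Polynomial.sum_def, finsetSum_coeff]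
  simp only [coeff_monomial]
  rw [Finset.sum_ite_eq']
  split_ifs with h
  · rfl
  · rw [notMem_support_iff.mp h, star_zero]

theorem pconj_pconj (p : Polynomial (Quaternion ℝ)) : pconj (pconj p) = p := by
  ext1 n
  rw [coeff_pconj, coeff_pconj, star_star]

theorem pconj_mul (p q : Polynomial (Quaternion ℝ)) :
    pconj (p * q) = pconj q * pconj p := by
  ext1 n
  rw [coeff_pconj, coeff_mul, coeff_mul, star_sum, ← Finset.Nat.sum_antidiagonal_swap]
  simp [coeff_pconj]

theorem pconj_C_qi : pconj (C qi) = -C qi := by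
  ext1 n
  rw [coeff_pconj, coeff_neg, coeff_C]
  split_ifs
  · ext <;> simp; simp [qi]
  · simp

/-- A polynomial with central coefficients is central. -/
theorem commute_of_coeff_commute {R : Type*} [Semiring R] {p : Polynomial R}
    (h : ∀ n a, Commute (p.coeff n) a) (q : Polynomial R) : Commute p q := by
  ext1 n
  rw [coeff_mul, coeff_mul, ← Finset.Nat.sum_antidiagonal_swap]
  exact Finset.sum_congr rfl fun x _ => h _ _

theorem toQ_commute (F : Polynomial ℝ) (q : Polynomial (Quaternion ℝ)) :
    Commute (toQ F) q := by
  refine commute_of_coeff_commute (fun n a => ?_) q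
  rw [toQ, coe_mapRingHom, coeff_map]
  exact Algebra.commutes _ _

/-- A polynomial fixed by conjugation has real coefficients, hence is central. -/
theorem commute_of_pconj_eq_self {p : Polynomial (Quaternion ℝ)} (hp : pconj p = p)
    (q : Polynomial (Quaternion ℝ)) : Commute p q := by
  refine commute_of_coeff_commute (fun n a => ?_) q
  have h : star (p.coeff n) = p.coeff n := by rw [← coeff_pconj, hp]
  rw [Quaternion.star_eq_self.mp h]
  exact Quaternion.coe_commute _ _

theorem pconj_mul_C_qi_mul_pconj (A : Polynomial (Quaternion ℝ)) :
    pconj (A * C qi * pconj A) = -(A * C qi * pconj A) := by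
  rw [pconj_mul, pconj_mul, pconj_pconj, pconj_C_qi]
  simp [mul_assoc]

theorem qi_mul_qi : qi * qi = -1 := by
  ext <;> simp <;> simp [qi] <;> rfl
theorem qj_mul_qj : qj * qj = -1 := by
  ext <;> simp <;> simp [qj] <;> rfl
theorem qk_mul_qk : qk * qk = -1 := by
  ext <;> simp <;> simp [qk] <;> rfl
theorem qj_mul_qi : qj * qi = -(qi * qj) := by
  ext <;> simp <;> simp [qi, qj]
theorem qk_mul_qi : qk * qi = -(qi * qk) := by
  ext <;> simp <;> simp [qi, qk]
theorem qk_mul_qj : qk * qj = -(qj * qk) := by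
  ext <;> simp <;> simp [qj, qk]

theorem mul_C_qi_mul_pconj_sq (A : Polynomial (Quaternion ℝ)) :
    (A * C qi * pconj A) ^ 2 = -(A * pconj A) ^ 2 := by
  have hN : Commute (pconj A * A) (C qi) :=
    commute_of_pconj_eq_self (by rw [pconj_mul, pconj_pconj]) _
  calc (A * C qi * pconj A) ^ 2
      = A * C qi * ((pconj A * A) * C qi) * pconj A := by simp only [sq, mul_assoc]
    _ = A * (C qi * C qi) * (pconj A * A) * pconj A := by rw [hN.eq]; simp only [mul_assoc]
    _ = -(A * pconj A) ^ 2 := by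
      rw [← C_mul, qi_mul_qi, C_neg, C_1]
      simp [sq, mul_assoc]

theorem vectorial_sq (F₁ F₂ F₃ : Polynomial ℝ) :
    (toQ F₁ * C qi + toQ F₂ * C qj + toQ F₃ * C qk) ^ 2
      = -toQ (F₁ ^ 2 + F₂ ^ 2 + F₃ ^ 2) := by
  have key (F G : Polynomial ℝ) (a b : Quaternion ℝ) :
      toQ F * C a * (toQ G * C b) = toQ (F * G) * C (a * b) := by
    rw [mul_assoc, ← mul_assoc (C a), ← (toQ_commute G (C a)).eq, map_mul, C_mul]
    simp only [mul_assoc]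
  simp only [sq, add_mul, mul_add, key, qi_mul_qi, qj_mul_qj, qk_mul_qk, qj_mul_qi,
    qk_mul_qi, qk_mul_qj, mul_comm F₂ F₁, mul_comm F₃ F₁, mul_comm F₃ F₂, C_neg, C_1,
    mul_neg, mul_one, map_add]
  abel

/-- For every `A ∈ ℍ[t]`, the polynomial `A·i·Ā` is vectorial, and writing
`A·i·Ā = F₁·i + F₂·j + F₃·k` with `F₁, F₂, F₃ ∈ ℝ[t]`, the Pythagorean condition
`F₁² + F₂² + F₃² = (A·Ā)²` holds in `ℝ[t]`. -/
theorem AiA_vectorial_and_pythagorean (A : Polynomial (Quaternion ℝ)) :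
    A * Polynomial.C qi * pconj A + pconj (A * Polynomial.C qi * pconj A) = 0 ∧
    ∀ F₁ F₂ F₃ : Polynomial ℝ,
      A * Polynomial.C qi * pconj A
        = toQ F₁ * Polynomial.C qi + toQ F₂ * Polynomial.C qj + toQ F₃ * Polynomial.C qk →
      toQ (F₁ ^ 2 + F₂ ^ 2 + F₃ ^ 2) = (A * pconj A) ^ 2 := by
  refine ⟨by rw [pconj_mul_C_qi_mul_pconj, add_neg_cancel], fun F₁ F₂ F₃ h => ?_⟩
  rw [← neg_inj, ← vectorial_sq, ← h, mul_C_qi_mul_pconj_sq]
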